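/- arXiv:1212.1836 — 6 statements merged into one kernel-verified Lean document; each statement's English description precedes it below -/
import Mathlib

section
/- Let R be a commutative ring and n a natural number. For every polynomial P ∈ R[x_1,…,x_n] there exists a finitely supported family (r_k)_{k ∈ ℕ^n} of elements of R such that for every tuple ℓ = (ℓ_1,…,ℓ_n) ∈ ℕ^n, the value of P at (ℓ_1,…,ℓ_n) (with natural numbers mapped into R via the canonical ring homomorphism ℕ → R) equals ∑_k r_k · binom(ℓ, k). -/
theorem choose_mul_aux (m k : ℕ) :
    m.choose k * m = (k + 1) * m.choose (k + 1) + k * m.choose k := by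
  have h := Nat.choose_succ_right_eq m k
  rcases le_or_gt k m with hk | hk
  · obtain ⟨d, rfl⟩ := Nat.exists_eq_add_of_le hk
    rw [Nat.add_sub_cancel_left] at h
    linarith [h, mul_add ((k + d).choose k) k d]
  · simp [Nat.choose_eq_zero_of_lt hk, Nat.choose_eq_zero_of_lt (Nat.lt_succ_of_lt hk)]

/-- Every polynomial `P ∈ R[x_1, …, x_n]` over a commutative ring `R`, viewed as a
function on `ℕ^n`, is a finitely supported `R`-linear combination of the multinomial
coefficient functions `ℓ ↦ ∏ i, C(ℓ i, k i)`. -/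
theorem mvPolynomial_eval_eq_linear_combination_of_binomials
    (R : Type*) [CommRing R] (n : ℕ) (P : MvPolynomial (Fin n) R) :
    ∃ r : (Fin n → ℕ) →₀ R, ∀ ℓ : Fin n → ℕ,
      MvPolynomial.eval (fun i => ((ℓ i : ℕ) : R)) P =
        r.sum fun k c => c * ∏ i, ((ℓ i).choose (k i) : R) := by
  classical
  let b : (Fin n → ℕ) → (Fin n → ℕ) → R := fun k ℓ => ∏ i, ((ℓ i).choose (k i) : R)
  suffices H : (fun ℓ : Fin n → ℕ => MvPolynomial.eval (fun i => ((ℓ i : ℕ) : R)) P) ∈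
      Submodule.span R (Set.range b) by
    obtain ⟨r, hr⟩ := Finsupp.mem_span_range_iff_exists_finsupp.1 H
    refine ⟨r, fun ℓ => ?_⟩
    have := congrFun hr ℓ
    simp only [Finsupp.sum, Finset.sum_apply, Pi.smul_apply, smul_eq_mul] at this
    rw [← this]
    rfl
  induction P using MvPolynomial.induction_on with
  | C a =>
    have : (fun ℓ : Fin n → ℕ => MvPolynomial.eval (fun i => ((ℓ i : ℕ) : R))
        (MvPolynomial.C a)) = a • b 0 := by
      funext ℓ
      simp [b]
    rw [this]
    exact Submodule.smul_mem _ _ (Submodule.subset_span ⟨0, rfl⟩)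
  | add p q hp hq =>
    simp only [map_add]
    exact Submodule.add_mem _ hp hq
  | mul_X p i hp =>
    simp only [map_mul, MvPolynomial.eval_X]
    have key : ∀ f ∈ Submodule.span R (Set.range b),
        f * (fun ℓ : Fin n → ℕ => ((ℓ i : ℕ) : R)) ∈ Submodule.span R (Set.range b) := by
      intro f hf
      induction hf using Submodule.span_induction with
      | mem x hx =>
        obtain ⟨k, rfl⟩ := hx
        have : b k * (fun ℓ : Fin n → ℕ => ((ℓ i : ℕ) : R)) =
            ((k i : R) + 1) • b (Function.update k i (k i + 1)) + (k i : R) • b k := by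
          funext ℓ
          have h := congrArg (Nat.cast : ℕ → R) (choose_mul_aux (ℓ i) (k i))
          push_cast at h
          have e : ∏ x ∈ Finset.univ.erase i,
              ((ℓ x).choose (Function.update k i (k i + 1) x) : R) =
              ∏ x ∈ Finset.univ.erase i, ((ℓ x).choose (k x) : R) := by
            refine Finset.prod_congr rfl fun x hx => ?_
            rw [Function.update_of_ne (Finset.ne_of_mem_erase hx)]
          simp only [b, Pi.mul_apply, Pi.add_apply, Pi.smul_apply, smul_eq_mul]
          rw [← Finset.mul_prod_erase _ _ (Finset.mem_univ i),
            ← Finset.mul_prod_erase _ (fun x => ((ℓ x).choose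
              (Function.update k i (k i + 1) x) : R)) (Finset.mem_univ i), e,
            Function.update_self]
          linear_combination (∏ x ∈ Finset.univ.erase i, ((ℓ x).choose (k x) : R)) * h
        rw [this]
        exact Submodule.add_mem _ (Submodule.smul_mem _ _ (Submodule.subset_span ⟨_, rfl⟩))
          (Submodule.smul_mem _ _ (Submodule.subset_span ⟨_, rfl⟩))
      | zero => simp
      | add x y _ _ hx hy => rw [add_mul]; exact Submodule.add_mem _ hx hy
      | smul a x _ hx => rw [smul_mul_assoc]; exact Submodule.smul_mem _ _ hx
    exact key _ hp
end

section
/- Let R be a commutative ring with no ℤ-torsion (i.e., for every nonzero integer m and every r ∈ R, m·r = 0 implies r = 0) and let n be a natural number. Every R-exponential-polynomial function f : ℕ^n → R may be expressed as a finite R-linear combination of basic exponential multinomials: there exist a finite set A of pairs (k, λ) with k ∈ ℕ^n and λ ∈ R^n, and elements r_{k,λ} ∈ R, such that for all ℓ ∈ ℕ^n, f(ℓ) = ∑_{(k,λ) ∈ A} r_{k,λ} · binom(ℓ, k) · λ^ℓ. -/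
/-- `f : ℕ^n → R` is an `R`-exponential-polynomial function: there are `m`, elements
`α_1, …, α_m ∈ R`, and a polynomial `P` in `n(m+1)` variables over `R` such that
`f ℓ = P(ℓ_1, …, ℓ_n; α_1^{ℓ_1}, …, α_m^{ℓ_1}, …, α_1^{ℓ_n}, …, α_m^{ℓ_n})`. -/
def IsExpPolyFun (R : Type*) [CommRing R] (n : ℕ) (f : (Fin n → ℕ) → R) : Prop :=
  ∃ (m : ℕ) (α : Fin m → R) (P : MvPolynomial (Fin n ⊕ Fin n × Fin m) R),
    ∀ ℓ : Fin n → ℕ,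
      f ℓ = MvPolynomial.eval
        (Sum.elim (fun i => ((ℓ i : ℕ) : R)) (fun p => α p.2 ^ ℓ p.1)) P

/-- The basic exponential multinomial attached to `p = (k, lam)`. -/
def basicEM (R : Type*) [CommRing R] (n : ℕ) (p : (Fin n → ℕ) × (Fin n → R)) :
    (Fin n → ℕ) → R :=
  fun l => (∏ i, ((l i).choose (p.1 i) : R)) * ∏ i, p.2 i ^ l i

lemma basicEM_mul_var (R : Type*) [CommRing R] (n : ℕ) (p : (Fin n → ℕ) × (Fin n → R))
    (i : Fin n) (l : Fin n → ℕ) :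
    basicEM R n p l * (l i : R) =
      ((p.1 i + 1 : ℕ) : R) * basicEM R n (Function.update p.1 i (p.1 i + 1), p.2) l
        + (p.1 i : R) * basicEM R n p l := by
  have key : ((l i).choose (p.1 i) : R) * (l i : R) =
      ((p.1 i + 1 : ℕ) : R) * ((l i).choose (p.1 i + 1) : R)
        + (p.1 i : R) * ((l i).choose (p.1 i) : R) := by
    have h := Nat.choose_succ_right_eq (l i) (p.1 i)
    by_cases hle : p.1 i ≤ l i
    · have h2 : (l i).choose (p.1 i) * l i =
          (p.1 i + 1) * (l i).choose (p.1 i + 1) + p.1 i * (l i).choose (p.1 i) := by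
        obtain ⟨d, hd⟩ := Nat.exists_eq_add_of_le hle
        rw [hd] at h ⊢
        rw [Nat.add_sub_cancel_left] at h
        linarith
      exact_mod_cast congrArg (Nat.cast : ℕ → R) h2
    · push Not at hle
      rw [Nat.choose_eq_zero_of_lt hle, Nat.choose_eq_zero_of_lt (by omega)]
      simp
  have hprod : ∏ j ∈ ({i}ᶜ : Finset (Fin n)),
      ((l j).choose (Function.update p.1 i (p.1 i + 1) j) : R) =
      ∏ j ∈ ({i}ᶜ : Finset (Fin n)), ((l j).choose (p.1 j) : R) := by
    refine Finset.prod_congr rfl fun j hj => ?_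
    rw [Function.update_of_ne (by simpa using hj)]
  unfold basicEM
  simp only
  rw [Fintype.prod_eq_mul_prod_compl i (fun j => ((l j).choose (p.1 j) : R)),
    Fintype.prod_eq_mul_prod_compl i
      (fun j => ((l j).choose (Function.update p.1 i (p.1 i + 1) j) : R)), hprod,
    Function.update_self]
  linear_combination (∏ j ∈ ({i}ᶜ : Finset (Fin n)), ((l j).choose (p.1 j) : R)) *
    (∏ j, p.2 j ^ l j) * key

lemma basicEM_mul_pow (R : Type*) [CommRing R] (n : ℕ) (p : (Fin n → ℕ) × (Fin n → R))
    (i : Fin n) (a : R) (l : Fin n → ℕ) :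
    basicEM R n p l * a ^ l i = basicEM R n (p.1, Function.update p.2 i (p.2 i * a)) l := by
  have hprod : ∏ j ∈ ({i}ᶜ : Finset (Fin n)), Function.update p.2 i (p.2 i * a) j ^ l j =
      ∏ j ∈ ({i}ᶜ : Finset (Fin n)), p.2 j ^ l j := by
    refine Finset.prod_congr rfl fun j hj => ?_
    rw [Function.update_of_ne (by simpa using hj)]
  unfold basicEM
  simp only
  rw [Fintype.prod_eq_mul_prod_compl i (fun j => p.2 j ^ l j),
    Fintype.prod_eq_mul_prod_compl i
      (fun j => Function.update p.2 i (p.2 i * a) j ^ l j), hprod,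
    Function.update_self, mul_pow]
  ring

lemma span_mul_mem (R : Type*) [CommRing R] (n : ℕ) (g : (Fin n → ℕ) → R)
    (hg : ∀ p, basicEM R n p * g ∈ Submodule.span R (Set.range (basicEM R n)))
    (f : (Fin n → ℕ) → R) (hf : f ∈ Submodule.span R (Set.range (basicEM R n))) :
    f * g ∈ Submodule.span R (Set.range (basicEM R n)) := by
  induction hf using Submodule.span_induction with
  | mem x hx => obtain ⟨p, rfl⟩ := hx; exact hg p
  | zero => simp
  | add x y _ _ hx hy => rw [add_mul]; exact Submodule.add_mem _ hx hy
  | smul a x _ hx => rw [smul_mul_assoc]; exact Submodule.smul_mem _ a hx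

/-- Over a commutative ring `R` with no `ℤ`-torsion, every `R`-exponential-polynomial
function is a finite `R`-linear combination of basic exponential multinomials
`ℓ ↦ binom(ℓ, k) * λ^ℓ`. -/
theorem expPoly_eq_linear_combination_of_basic_exponential_multinomials
    (R : Type*) [CommRing R]
    (htf : ∀ m : ℤ, m ≠ 0 → ∀ r : R, m • r = 0 → r = 0)
    (n : ℕ) (f : (Fin n → ℕ) → R) (hf : IsExpPolyFun R n f) :
    ∃ (A : Finset ((Fin n → ℕ) × (Fin n → R))) (c : (Fin n → ℕ) × (Fin n → R) → R),
      ∀ ℓ : Fin n → ℕ,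
        f ℓ = ∑ p ∈ A, c p * (∏ i, ((ℓ i).choose (p.1 i) : R)) * ∏ i, p.2 i ^ ℓ i := by
  obtain ⟨m, α, P, hP⟩ := hf
  have hmem : f ∈ Submodule.span R (Set.range (basicEM R n)) := by
    rw [show f = _ from funext hP]
    clear hP
    induction P using MvPolynomial.induction_on with
    | C a =>
      have : (fun l : Fin n → ℕ => MvPolynomial.eval
          (Sum.elim (fun i => ((l i : ℕ) : R)) (fun p : Fin n × Fin m => α p.2 ^ l p.1))
          (MvPolynomial.C a)) = a • basicEM R n (0, 1) := by
        funext l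
        simp [basicEM]
      rw [this]
      exact Submodule.smul_mem _ _ (Submodule.subset_span ⟨_, rfl⟩)
    | add p q hp hq =>
      simp only [map_add]
      exact Submodule.add_mem _ hp hq
    | mul_X p s hp =>
      simp only [map_mul, MvPolynomial.eval_X]
      refine span_mul_mem R n _ (fun q => ?_) _ hp
      rcases s with i | ⟨i, j⟩
      · have : basicEM R n q * (fun l : Fin n → ℕ => Sum.elim (fun i => ((l i : ℕ) : R))
            (fun p : Fin n × Fin m => α p.2 ^ l p.1) (Sum.inl i)) =
            ((q.1 i + 1 : ℕ) : R) • basicEM R n (Function.update q.1 i (q.1 i + 1), q.2)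
              + (q.1 i : R) • basicEM R n q := by
          funext l
          exact basicEM_mul_var R n q i l
        rw [this]
        exact Submodule.add_mem _ (Submodule.smul_mem _ _ (Submodule.subset_span ⟨_, rfl⟩))
          (Submodule.smul_mem _ _ (Submodule.subset_span ⟨_, rfl⟩))
      · exact Submodule.subset_span ⟨_, (funext fun l => basicEM_mul_pow R n q i (α j) l).symm⟩
  obtain ⟨c, hc⟩ := Finsupp.mem_span_range_iff_exists_finsupp.mp hmem
  refine ⟨c.support, c, fun l => ?_⟩
  rw [← hc, Finsupp.sum, Finset.sum_apply]
  refine Finset.sum_congr rfl fun p _ => ?_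
  simp [basicEM, mul_assoc]
end

section
/- Let R be a commutative ring, n a natural number, λ = (λ_1,…,λ_n) ∈ R^n, and M = (M_1,…,M_n) ∈ ℕ^n, and let N ≥ 1 be a natural number. For i = 1,…,n set ψ_i := λ_i·(I_N + J_N^{M_i}) ∈ M_{N×N}(R). Then the matrices ψ_1,…,ψ_n pairwise commute, and for every ℓ = (ℓ_1,…,ℓ_n) ∈ ℕ^n and every m with 0 ≤ m ≤ N−1, the (m+1)-st coordinate of the vector ψ_1^{ℓ_1}·⋯·ψ_n^{ℓ_n}·e_1 ∈ R^N equals ∑_{k ∈ ℕ^n, k·M = m} λ^ℓ · binom(ℓ, k). -/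
open Matrix

/-- The `N × N` matrix with `1`s on the subdiagonal and `0`s elsewhere. -/
def subdiagMatrix (R : Type*) [CommRing R] (N : ℕ) : Matrix (Fin N) (Fin N) R :=
  Matrix.of fun a b => if (a : ℕ) = (b : ℕ) + 1 then 1 else 0

theorem subdiagMatrix_pow_apply (R : Type*) [CommRing R] (N d : ℕ) (a b : Fin N) :
    (subdiagMatrix R N ^ d) a b = if (a : ℕ) = (b : ℕ) + d then 1 else 0 := by
  induction d generalizing a b with
  | zero => simp [Matrix.one_apply, Fin.ext_iff]
  | succ d ih =>
    rw [pow_succ, Matrix.mul_apply]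
    simp only [ih]
    simp only [subdiagMatrix, Matrix.of_apply]
    by_cases hb : (b : ℕ) + 1 < N
    · rw [Finset.sum_eq_single (⟨(b : ℕ) + 1, hb⟩ : Fin N)]
      · simp [add_assoc, add_comm, add_left_comm]
      · intro c _ hc
        have : ¬ ((c : ℕ) = b + 1) := fun h => hc (Fin.ext h)
        simp [this]
      · simp
    · rw [Finset.sum_eq_zero, if_neg]
      · have := a.2
        omega
      · intro c _
        have : ¬ ((c : ℕ) = b + 1) := by have := c.2; omega
        simp [this]

open Polynomial in
theorem shift_poly_expand {R : Type*} [CommRing R] {n : ℕ} (lam : Fin n → R) (M ℓ : Fin n → ℕ) :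
    ∏ i, (lam i • (1 + (X : R[X]) ^ M i)) ^ ℓ i =
      ∑ k ∈ Fintype.piFinset (fun i => Finset.range (ℓ i + 1)),
        ((∏ i, lam i ^ ℓ i) * ∏ i, ((ℓ i).choose (k i) : R)) • (X : R[X]) ^ (∑ i, k i * M i) := by
  have h : ∀ i, (lam i • (1 + (X : R[X]) ^ M i)) ^ ℓ i =
      ∑ j ∈ Finset.range (ℓ i + 1),
        C (lam i ^ ℓ i) * C ((ℓ i).choose j : R) * (X : R[X]) ^ (j * M i) := by
    intro i
    rw [_root_.smul_pow, add_comm, add_pow, Finset.smul_sum]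
    refine Finset.sum_congr rfl fun j _ => ?_
    rw [smul_eq_C_mul, ← pow_mul, mul_comm (M i) j]
    simp
    ring
  simp only [h]
  rw [Finset.prod_univ_sum]
  refine Finset.sum_congr rfl fun k _ => ?_
  rw [Finset.prod_mul_distrib, Finset.prod_mul_distrib, Finset.prod_pow_eq_pow_sum,
    smul_eq_C_mul, C_mul, map_prod, map_prod]

/-- Let `ψ i := λ i • (I + J^{M i})` for `i = 1, …, n`, where `J` is the `N × N`
subdiagonal matrix.  Then the `ψ i` pairwise commute and, for every `ℓ ∈ ℕ^n` and
every `m` with `0 ≤ m ≤ N - 1`, the `(m+1)`-st coordinate of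
`ψ_1^{ℓ_1} ⋯ ψ_n^{ℓ_n} e_1` is `∑_{k·M = m} λ^ℓ · binom(ℓ, k)`. -/
theorem coordinates_of_shift_dynamics
    (R : Type*) [CommRing R] (n : ℕ) (lam : Fin n → R) (M : Fin n → ℕ)
    (N : ℕ) (hN : 1 ≤ N)
    (ψ : Fin n → Matrix (Fin N) (Fin N) R)
    (hψ : ∀ i, ψ i = lam i • (1 + (subdiagMatrix R N) ^ (M i))) :
    (∀ i i', ψ i * ψ i' = ψ i' * ψ i) ∧
      ∀ (ℓ : Fin n → ℕ) (m : Fin N),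
        ((List.ofFn fun i => ψ i ^ ℓ i).prod *ᵥ
            (Pi.single (⟨0, hN⟩ : Fin N) 1)) m =
          ∑ᶠ (k : Fin n → ℕ) (_ : ∑ i, k i * M i = (m : ℕ)),
            (∏ i, lam i ^ ℓ i) * ∏ i, ((ℓ i).choose (k i) : R) := by
  constructor
  · intro i i'
    have hc : Commute (1 + subdiagMatrix R N ^ M i) (1 + subdiagMatrix R N ^ M i') :=
      ((Commute.one_left _).add_left
        ((Commute.one_right _).add_right (Commute.pow_pow_self _ _ _)))
    rw [hψ, hψ]
    exact ((hc.smul_left (lam i)).smul_right (lam i')).eq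
  · intro ℓ m
    have hP : (List.ofFn fun i => ψ i ^ ℓ i).prod =
        Polynomial.aeval (subdiagMatrix R N)
          (∏ i, (lam i • (1 + (Polynomial.X : Polynomial R) ^ M i)) ^ ℓ i) := by
      rw [← List.prod_ofFn, map_list_prod, List.map_ofFn]
      congr 2
      funext i
      simp [hψ]
    rw [hP, shift_poly_expand, Matrix.mulVec_single_one, Matrix.col_apply, map_sum,
      Matrix.sum_apply]
    simp only [map_smul, map_pow, Polynomial.aeval_X, Matrix.smul_apply,
      subdiagMatrix_pow_apply, zero_add, smul_eq_mul, mul_ite, mul_one, mul_zero]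
    rw [finsum_eq_sum_of_support_subset (s := Fintype.piFinset (fun i => Finset.range (ℓ i + 1)))]
    · refine Finset.sum_congr rfl fun k _ => ?_
      rw [finsum_eq_if]
      simp only [eq_comm]
    · intro k hk
      simp only [Finset.mem_coe, Fintype.mem_piFinset, Finset.mem_range]
      intro i
      by_contra hi
      apply hk
      have : ∏ i, ((ℓ i).choose (k i) : R) = 0 :=
        Finset.prod_eq_zero (Finset.mem_univ i)
          (by rw [Nat.choose_eq_zero_of_lt (by omega), Nat.cast_zero])
      simp [this]
end

section
/- Let R be a commutative ring, n a natural number, λ = (λ_1,…,λ_n) ∈ R^n, and j = (j_1,…,j_n) ∈ ℕ^n. Then there exist a natural number N, pairwise commuting matrices ψ_1,…,ψ_n ∈ M_{N×N}(R), a vector v ∈ R^N, and an R-linear map π : R^N → R such that for all ℓ = (ℓ_1,…,ℓ_n) ∈ ℕ^n, π(ψ_1^{ℓ_1}·⋯·ψ_n^{ℓ_n}·v) = λ^ℓ · binom(ℓ, j). -/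
open Matrix

/-- External (Kronecker) product of a family of square matrices. -/
def kronHom {R : Type*} [CommRing R] {n : ℕ} (κ : Fin n → Type) [∀ i, Fintype (κ i)]
    [∀ i, DecidableEq (κ i)] :
    (∀ i, Matrix (κ i) (κ i) R) →* Matrix (∀ i, κ i) (∀ i, κ i) R where
  toFun A := Matrix.of fun a b => ∏ i, A i (a i) (b i)
  map_one' := by
    ext a b
    simp only [Matrix.of_apply, Pi.one_apply, Matrix.one_apply]
    rw [Finset.prod_ite_zero]
    simp [funext_iff]
  map_mul' A B := by
    ext a b
    simp only [Matrix.of_apply, Pi.mul_apply, Matrix.mul_apply, ← Finset.prod_mul_distrib]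
    rw [Finset.prod_univ_sum, Fintype.piFinset_univ]

/-- Jordan-type block. -/
def jblock {R : Type*} [CommRing R] (c : R) (j : ℕ) : Matrix (Fin (j+1)) (Fin (j+1)) R :=
  Matrix.of fun a b => c * ((if b = a then 1 else 0) + (if (b : ℕ) + 1 = a then 1 else 0))

lemma jblock_pow {R : Type*} [CommRing R] (c : R) (j : ℕ) (m : ℕ) :
    ∀ a : Fin (j+1), (jblock c j ^ m) a 0 = c ^ m * (m.choose a : R) := by
  induction m with
  | zero =>
    intro a
    refine Fin.cases ?_ (fun a => ?_) a <;> simp [Matrix.one_apply]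
  | succ m ih =>
    intro a
    rw [pow_succ', Matrix.mul_apply]
    simp only [ih]
    simp only [jblock, Matrix.of_apply, mul_add, add_mul, Finset.sum_add_distrib]
    refine Fin.cases ?_ (fun a => ?_) a
    · simp [pow_succ']
    · have h : ∀ x : Fin (j+1), ((x : ℕ) + 1 = (a.succ : Fin (j+1))) ↔ x = a.castSucc := by
        intro x; simp [Fin.ext_iff]
      simp only [h]
      simp [Nat.choose_succ_succ]
      ring

lemma list_ofFn_mulSingle {n : ℕ} {M : Fin n → Type*} [∀ i, Monoid (M i)] (x : ∀ i, M i) :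
    (List.ofFn fun i => (Pi.mulSingle i (x i) : ∀ i, M i)).prod = x := by
  funext k
  change Pi.evalMonoidHom M k (List.prod _) = _
  rw [map_list_prod, List.map_ofFn]
  induction n with
  | zero => exact k.elim0
  | succ n ih =>
    rw [List.ofFn_succ, List.prod_cons]
    refine Fin.cases ?_ (fun k => ?_) k
    · have : ∀ i : Fin n, (0 : Fin (n+1)) ≠ i.succ := fun i => (Fin.succ_ne_zero i).symm
      simp [Pi.mulSingle_eq_of_ne (this _)]
    · have h := ih (M := fun i => M i.succ) (fun i => x i.succ) k
      have h0 : (Pi.mulSingle 0 (x 0) : ∀ i, M i) k.succ = 1 :=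
        Pi.mulSingle_eq_of_ne (Fin.succ_ne_zero k) _
      simp only [Function.comp_apply, Pi.evalMonoidHom_apply, h0, one_mul]
      refine Eq.trans ?_ h
      congr 2
      funext i
      by_cases hi : k = i
      · subst hi; simp
      · have : k.succ ≠ i.succ := fun h => hi (Fin.succ_injective _ h)
        simp [Pi.mulSingle_eq_of_ne this, Pi.mulSingle_eq_of_ne hi]

/-- For any commutative ring `R`, `λ ∈ R^n` and `j ∈ ℕ^n` there are `N`, pairwise
commuting `N × N` matrices `ψ_1, …, ψ_n` over `R`, a vector `v ∈ R^N` and an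
`R`-linear map `π : R^N → R` with
`π(ψ_1^{ℓ_1} ⋯ ψ_n^{ℓ_n} v) = λ^ℓ · binom(ℓ, j)` for all `ℓ ∈ ℕ^n`. -/
theorem basic_exponential_multinomial_as_linear_dynamics
    (R : Type*) [CommRing R] (n : ℕ) (lam : Fin n → R) (j : Fin n → ℕ) :
    ∃ (N : ℕ) (ψ : Fin n → Matrix (Fin N) (Fin N) R) (v : Fin N → R)
      (π : (Fin N → R) →ₗ[R] R),
      (∀ i i', ψ i * ψ i' = ψ i' * ψ i) ∧
      ∀ ℓ : Fin n → ℕ,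
        π ((List.ofFn fun i => ψ i ^ ℓ i).prod *ᵥ v) =
          (∏ i, lam i ^ ℓ i) * ∏ i, ((ℓ i).choose (j i) : R) := by
  let κ : Fin n → Type := fun i => Fin (j i + 1)
  let e := Fintype.equivFin (∀ i, κ i)
  let B : ∀ i, Matrix (κ i) (κ i) R := fun i => jblock (lam i) (j i)
  let F : (∀ i, Matrix (κ i) (κ i) R) →*
      Matrix (Fin (Fintype.card (∀ i, κ i))) (Fin (Fintype.card (∀ i, κ i))) R :=
    (Matrix.reindexAlgEquiv R R e).toMulEquiv.toMonoidHom.comp (kronHom κ)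
  refine ⟨_, fun i => F (Pi.mulSingle i (B i)), Pi.single (e fun i => (0 : Fin (j i + 1))) 1,
    LinearMap.proj (e fun i => Fin.last (j i)), ?_, ?_⟩
  · intro i i'
    rw [← map_mul, ← map_mul]
    congr 1
    by_cases h : i = i'
    · subst h; rfl
    · exact Pi.mulSingle_commute h _ _
  · intro ℓ
    have h : (List.ofFn fun i => F (Pi.mulSingle i (B i)) ^ ℓ i).prod
        = F (fun i => B i ^ ℓ i) := by
      rw [← list_ofFn_mulSingle (fun i => B i ^ ℓ i), map_list_prod, List.map_ofFn]
      congr 2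
      funext i
      simp [Pi.mulSingle_pow]
    rw [h]
    simp only [LinearMap.proj_apply, Matrix.mulVec_single_one, ← Finset.prod_mul_distrib]
    simp [F, kronHom, B]
    refine Finset.prod_congr rfl fun i _ => ?_
    exact jblock_pow (lam i) (j i) (ℓ i) (Fin.last (j i))
end

section
/- Let R be a commutative ring with no ℤ-torsion (i.e., for every nonzero integer m and every r ∈ R, m·r = 0 implies r = 0), let n be a natural number, and let Z ⊆ ℕ^n be an R-exponential-polynomial set. Then there exist natural numbers r and s, pairwise commuting R-module endomorphisms ψ_1,…,ψ_n of the free module R^r, a vector a ∈ R^r, and an R-linear map θ : R^r → R^s such that Z = { (ℓ_1,…,ℓ_n) ∈ ℕ^n : θ(ψ_1^{∘ℓ_1} ∘ ⋯ ∘ ψ_n^{∘ℓ_n}(a)) = 0 }. -/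
/-- `Z ⊆ ℕ^n` is an `R`-exponential-polynomial set: a finite intersection of zero
sets of `R`-exponential-polynomial functions. -/
def IsExpPolySet (R : Type*) [CommRing R] (n : ℕ) (Z : Set (Fin n → ℕ)) : Prop :=
  ∃ (m : ℕ) (f : Fin m → ((Fin n → ℕ) → R)),
    (∀ i, IsExpPolyFun R n (f i)) ∧ Z = ⋂ i, {ℓ | f i ℓ = 0}

/-- The map `Φ_1^{∘ℓ_1} ∘ ⋯ ∘ Φ_n^{∘ℓ_n}`. -/
def iterComp {X : Type*} {n : ℕ} (Φ : Fin n → X → X) (ℓ : Fin n → ℕ) : X → X :=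
  (List.ofFn fun i => (Φ i)^[ℓ i]).foldr (· ∘ ·) id

section Helpers

universe u

open scoped TensorProduct

/-- `f` is the linear readout of the trajectory of commuting endomorphisms of a finite free
module. -/
def LinRep {R : Type u} [CommRing R] {n : ℕ} {W : Type u} [AddCommGroup W] [Module R W]
    (f : (Fin n → ℕ) → W) : Prop :=
  ∃ (V : Type u) (_ : AddCommGroup V) (_ : Module R V) (_ : Module.Finite R V)
    (_ : Module.Free R V) (ψ : Fin n → V →ₗ[R] V) (v : (Fin n → ℕ) → V) (θ : V →ₗ[R] W),
    (∀ i j x, ψ i (ψ j x) = ψ j (ψ i x)) ∧ (∀ i ℓ, v (ℓ + Pi.single i 1) = ψ i (v ℓ)) ∧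
    ∀ ℓ, f ℓ = θ (v ℓ)

theorem LinRep.toFin {R : Type u} [CommRing R] {n : ℕ} {W : Type u} [AddCommGroup W] [Module R W]
    {f : (Fin n → ℕ) → W} (h : LinRep (R := R) f) :
    ∃ (r : ℕ) (ψ : Fin n → (Fin r → R) →ₗ[R] (Fin r → R)) (v : (Fin n → ℕ) → (Fin r → R))
      (θ : (Fin r → R) →ₗ[R] W),
    (∀ i j x, ψ i (ψ j x) = ψ j (ψ i x)) ∧ (∀ i ℓ, v (ℓ + Pi.single i 1) = ψ i (v ℓ)) ∧
    ∀ ℓ, f ℓ = θ (v ℓ) := by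
  obtain ⟨V, _, _, _, _, ψ, v, θ, h1, h2, h3⟩ := h
  let b := Module.Free.chooseBasis R V
  let e : V ≃ₗ[R] (Fin (Fintype.card (Module.Free.ChooseBasisIndex R V)) → R) :=
    (b.reindex (Fintype.equivFin _)).equivFun
  refine ⟨_, fun i => e.toLinearMap ∘ₗ ψ i ∘ₗ e.symm.toLinearMap, fun ℓ => e (v ℓ),
    θ ∘ₗ e.symm.toLinearMap, ?_, ?_, ?_⟩
  · intro i j x
    simp [h1 i j]
  · intro i ℓ
    simp [h2]
  · intro ℓ
    simp [h3]

theorem LinRep.const {R : Type u} [CommRing R] {n : ℕ} (c : R) :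
    LinRep (R := R) (fun _ : Fin n → ℕ => c) :=
  ⟨R, inferInstance, inferInstance, inferInstance, inferInstance, fun _ => LinearMap.id,
    fun _ => c, LinearMap.id, by simp, by simp, by simp⟩

theorem LinRep.coord {R : Type u} [CommRing R] {n : ℕ} (k : Fin n) :
    LinRep (R := R) (fun ℓ : Fin n → ℕ => (ℓ k : R)) := by
  refine ⟨R × R, inferInstance, inferInstance, inferInstance, inferInstance,
    fun i => if i = k then
      (LinearMap.fst R R R + LinearMap.snd R R R).prod (LinearMap.snd R R R) else LinearMap.id,
    fun ℓ => ((ℓ k : R), 1), LinearMap.fst R R R, ?_, ?_, by simp⟩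
  · intro i j x
    by_cases hi : i = k <;> by_cases hj : j = k <;> simp [hi, hj]
  · intro i ℓ
    by_cases hi : i = k
    · subst hi; simp
    · simp [hi, Pi.single_apply, Ne.symm hi]

theorem LinRep.expo {R : Type u} [CommRing R] {n : ℕ} (k : Fin n) (α : R) :
    LinRep (R := R) (fun ℓ : Fin n → ℕ => α ^ ℓ k) := by
  refine ⟨R, inferInstance, inferInstance, inferInstance, inferInstance,
    fun i => if i = k then α • LinearMap.id else LinearMap.id,
    fun ℓ => α ^ ℓ k, LinearMap.id, ?_, ?_, by simp⟩
  · intro i j x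
    by_cases hi : i = k <;> by_cases hj : j = k <;> simp [hi, hj]
  · intro i ℓ
    by_cases hi : i = k
    · subst hi; simp [pow_succ, mul_comm]
    · simp [hi, Pi.single_apply, Ne.symm hi]

theorem LinRep.add {R : Type u} [CommRing R] {n : ℕ} {f g : (Fin n → ℕ) → R}
    (hf : LinRep (R := R) f) (hg : LinRep (R := R) g) :
    LinRep (R := R) (fun ℓ => f ℓ + g ℓ) := by
  obtain ⟨V, _, _, _, _, ψ, v, θ, h1, h2, h3⟩ := hf
  obtain ⟨V', _, _, _, _, ψ', v', θ', h1', h2', h3'⟩ := hg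
  refine ⟨V × V', inferInstance, inferInstance, inferInstance, inferInstance,
    fun i => (ψ i).prodMap (ψ' i), fun ℓ => (v ℓ, v' ℓ), θ.coprod θ', ?_, ?_, ?_⟩
  · intro i j x
    simp [h1 i j, h1' i j]
  · intro i ℓ
    simp [h2, h2']
  · intro ℓ
    simp [h3, h3']

theorem LinRep.mul {R : Type u} [CommRing R] {n : ℕ} {f g : (Fin n → ℕ) → R}
    (hf : LinRep (R := R) f) (hg : LinRep (R := R) g) :
    LinRep (R := R) (fun ℓ => f ℓ * g ℓ) := by
  obtain ⟨V, _, _, _, _, ψ, v, θ, h1, h2, h3⟩ := hf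
  obtain ⟨V', _, _, _, _, ψ', v', θ', h1', h2', h3'⟩ := hg
  refine ⟨TensorProduct R V V', inferInstance, inferInstance, inferInstance, inferInstance,
    fun i => TensorProduct.map (ψ i) (ψ' i), fun ℓ => v ℓ ⊗ₜ[R] v' ℓ,
    LinearMap.mul' R R ∘ₗ TensorProduct.map θ θ', ?_, ?_, ?_⟩
  · intro i j x
    induction x with
    | zero => simp
    | tmul x y => simp [h1 i j, h1' i j]
    | add x y hx hy => simp only [map_add, hx, hy]
  · intro i ℓ
    simp [h2, h2']
  · intro ℓ
    simp [h3, h3']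

theorem LinRep.pi {R : Type u} [CommRing R] {n m : ℕ} {f : Fin m → (Fin n → ℕ) → R}
    (hf : ∀ k, LinRep (R := R) (f k)) :
    LinRep (R := R) (fun ℓ k => f k ℓ) := by
  choose r ψ v θ h1 h2 h3 using fun k => (hf k).toFin
  refine ⟨(k : Fin m) → Fin (r k) → R, inferInstance, inferInstance, inferInstance, inferInstance,
    fun i => LinearMap.pi fun k => ψ k i ∘ₗ LinearMap.proj k, fun ℓ k => v k ℓ,
    LinearMap.pi fun k => θ k ∘ₗ LinearMap.proj k, ?_, ?_, ?_⟩
  · intro i j x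
    funext k
    simp [h1 k i j]
  · intro i ℓ
    funext k
    simp [h2]
  · intro ℓ
    funext k
    simp [h3]

theorem IsExpPolyFun.linRep {R : Type u} [CommRing R] {n : ℕ} {f : (Fin n → ℕ) → R}
    (hf : IsExpPolyFun R n f) : LinRep (R := R) f := by
  obtain ⟨m, α, P, hP⟩ := hf
  obtain rfl := funext hP
  clear hP
  induction P using MvPolynomial.induction_on with
  | C c => simpa using LinRep.const c
  | add p q hp hq => simpa using hp.add hq
  | mul_X p x hp =>
    rcases x with i | ⟨i, j⟩
    · simpa using hp.mul (LinRep.coord i)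
    · simpa using hp.mul (LinRep.expo i (α j))

theorem iterComp_traj {X : Type*} {n : ℕ} (Φ : Fin n → X → X) (v : (Fin n → ℕ) → X)
    (h : ∀ i ℓ, v (ℓ + Pi.single i 1) = Φ i (v ℓ)) (ℓ : Fin n → ℕ) :
    iterComp Φ ℓ (v 0) = v ℓ := by
  induction n with
  | zero =>
    rw [Subsingleton.elim ℓ 0]
    simp [iterComp]
  | succ n ih =>
    have key : ∀ k : ℕ, (Φ 0)^[k] (v (Fin.cons 0 (Fin.tail ℓ))) = v (Fin.cons k (Fin.tail ℓ)) := by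
      intro k
      induction k with
      | zero => rfl
      | succ k ihk =>
        rw [Function.iterate_succ_apply', ihk, ← h]
        congr 1
        funext j
        refine Fin.cases ?_ (fun j => ?_) j <;> simp
    have h' := ih (fun i => Φ i.succ) (fun ℓ' => v (Fin.cons 0 ℓ')) (by
      intro i ℓ'
      rw [← h]
      congr 1
      funext j
      refine Fin.cases ?_ (fun j => ?_) j <;> simp [Pi.single_apply]) (Fin.tail ℓ)
    have h0 : (Fin.cons 0 (0 : Fin n → ℕ) : Fin (n + 1) → ℕ) = 0 := by
      funext j
      refine Fin.cases ?_ (fun j => ?_) j <;> simp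
    have hs : iterComp Φ ℓ (v 0) =
        (Φ 0)^[ℓ 0] (iterComp (fun i => Φ i.succ) (Fin.tail ℓ) (v 0)) := by
      simp [iterComp, List.ofFn_succ, Fin.tail]
    simp only [h0] at h'
    rw [hs, h', key, Fin.cons_self_tail]

end Helpers

/-- Over a commutative ring `R` with no `ℤ`-torsion, every `R`-exponential-polynomial
set is the return set of a linear dynamical system on a finite-rank free `R`-module,
with target the kernel of an `R`-linear map to a finite-rank free `R`-module. -/
theorem expPolySet_is_linear_return_set
    (R : Type*) [CommRing R]
    (htf : ∀ m : ℤ, m ≠ 0 → ∀ r : R, m • r = 0 → r = 0)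
    (n : ℕ) (Z : Set (Fin n → ℕ)) (hZ : IsExpPolySet R n Z) :
    ∃ (r s : ℕ) (ψ : Fin n → Module.End R (Fin r → R)) (a : Fin r → R)
      (θ : (Fin r → R) →ₗ[R] (Fin s → R)),
      (∀ i i', ψ i * ψ i' = ψ i' * ψ i) ∧
      Z = {ℓ | θ (iterComp (fun i => ⇑(ψ i)) ℓ a) = 0} := by
  obtain ⟨m, f, hf, rfl⟩ := hZ
  obtain ⟨r, ψ, v, θ, h1, h2, h3⟩ := (LinRep.pi fun k => (hf k).linRep).toFin
  refine ⟨r, m, ψ, v 0, θ, fun i j => LinearMap.ext (h1 i j), ?_⟩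
  ext ℓ
  simp only [Set.mem_iInter, Set.mem_setOf_eq]
  rw [iterComp_traj (fun i => ⇑(ψ i)) v h2 ℓ, ← h3, funext_iff]
  rfl
end

section
/- Let 𝒪 be the ring of all algebraic integers (the integral closure of ℤ in an algebraic closure of ℚ, or equivalently in ℂ), let n be a natural number, and let Z ⊆ ℕ^n be an 𝒪-exponential-polynomial set. Then there exist natural numbers N and s, pairwise commuting integer matrices A_1,…,A_n ∈ M_{N×N}(ℤ), a matrix B ∈ M_{s×N}(ℤ), and a point P ∈ (ℚ^×)^N such that, setting Φ_i := Φ_{A_i} : (ℚ^×)^N → (ℚ^×)^N and Y := ker(Φ_B) ≤ (ℚ^×)^N, one has Z = { (ℓ_1,…,ℓ_n) ∈ ℕ^n : Φ_1^{∘ℓ_1} ∘ ⋯ ∘ Φ_n^{∘ℓ_n}(P) ∈ Y }. -/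
open Matrix

/-- The ring of all algebraic integers: the integral closure of `ℤ` in an algebraic
closure of `ℚ`. -/
noncomputable def AlgInt : Type := integralClosure ℤ (AlgebraicClosure ℚ)

noncomputable instance : CommRing AlgInt :=
  inferInstanceAs (CommRing (integralClosure ℤ (AlgebraicClosure ℚ)))

/-- The group homomorphism `(ℚ^×)^N → (ℚ^×)^s` associated to an integer matrix `A`,
`x ↦ (∏ j, x_j ^ A i j)_i`; these are exactly the `ℚ`-point maps of algebraic-group
homomorphisms `𝔾_m^N → 𝔾_m^s`, and their kernels are exactly the `ℚ`-points of
algebraic subgroups of `𝔾_m^N`. -/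
def monomialMap {s N : ℕ} (A : Matrix (Fin s) (Fin N) ℤ) :
    (Fin N → ℚˣ) →* (Fin s → ℚˣ) where
  toFun x := fun i => ∏ j, x j ^ A i j
  map_one' := by
    funext i
    simp
  map_mul' x y := by
    funext i
    simp [mul_zpow, Finset.prod_mul_distrib]

namespace TorusReturn

lemma iterComp_semiconj {X Y : Type*} {n : ℕ} (Φ : Fin n → X → X) (Ψ : Fin n → Y → Y)
    (e : Y → X) (h : ∀ i y, Φ i (e y) = e (Ψ i y)) (ℓ : Fin n → ℕ) (y : Y) :
    iterComp Φ ℓ (e y) = e (iterComp Ψ ℓ y) := by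
  induction n generalizing y with
  | zero => simp [iterComp]
  | succ n ih =>
    have h1 := ih (fun i => Φ i.succ) (fun i => Ψ i.succ) (fun i y => h _ y)
      (fun i => ℓ i.succ) y
    simp only [iterComp, List.ofFn_succ, List.foldr_cons, Function.comp_apply] at h1 ⊢
    rw [h1]
    have h2 : Function.Semiconj e (Ψ 0) (Φ 0) := fun y => (h 0 y).symm
    exact ((h2.iterate_right (ℓ 0)) _).symm

/-- translation of functions -/
def shift {D : Type*} (H : Type*) [AddCommMonoid D] [AddCommGroup H] (d : D) :
    (D → H) →ₗ[ℤ] (D → H) where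
  toFun g := fun x => g (x + d)
  map_add' _ _ := rfl
  map_smul' _ _ := rfl

lemma shift_apply {D H : Type*} [AddCommMonoid D] [AddCommGroup H] (d : D) (g : D → H) (x : D) :
    shift H d g x = g (x + d) := rfl

lemma iterComp_shift {D H : Type*} [AddCommMonoid D] [AddCommGroup H] {n : ℕ} (d : Fin n → D)
    (ℓ : Fin n → ℕ) (g : D → H) (x : D) :
    iterComp (fun i => ⇑(shift H (d i))) ℓ g x = g (x + ∑ i, ℓ i • d i) := by
  induction n generalizing x with
  | zero => simp [iterComp]
  | succ n ih =>
    have h1 := ih (fun i => d i.succ) (fun i => ℓ i.succ)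
    have h2 : ∀ (k : ℕ) (d : D) (g : D → H) (x : D), (⇑(shift H d))^[k] g x
        = g (x + k • d) := by
      intro k d g
      induction k with
      | zero => simp
      | succ k ih =>
        intro x
        rw [Function.iterate_succ_apply', shift_apply, ih, succ_nsmul', add_assoc]
    simp only [iterComp, List.ofFn_succ, List.foldr_cons, Function.comp_apply] at h1 ⊢
    rw [h2, h1, Fin.sum_univ_succ, add_assoc]

/-- functions lying in a finitely generated translation-stable module -/
def Rec {D H : Type*} [AddCommMonoid D] [AddCommGroup H] (f : D → H) : Prop :=
  ∃ M : Submodule ℤ (D → H), M.FG ∧ (∀ d : D, ∀ g ∈ M, shift H d g ∈ M) ∧ f ∈ M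

section
variable {D H H' R : Type*} [AddCommMonoid D] [AddCommGroup H] [AddCommGroup H'] [CommRing R]

lemma Rec.add {f g : D → H} (hf : Rec f) (hg : Rec g) : Rec (f + g) := by
  obtain ⟨M, hM, hs, hfM⟩ := hf
  obtain ⟨M', hM', hs', hfM'⟩ := hg
  refine ⟨M ⊔ M', hM.sup hM', ?_, Submodule.add_mem_sup hfM hfM'⟩
  intro d g hg
  obtain ⟨a, ha, b, hb, rfl⟩ := Submodule.mem_sup.1 hg
  rw [map_add]
  exact Submodule.add_mem_sup (hs d a ha) (hs' d b hb)

lemma Rec.zero : Rec (0 : D → H) :=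
  ⟨⊥, Submodule.fg_bot, by simp, by simp⟩

lemma Rec.sum {ι : Type*} (s : Finset ι) (f : ι → D → H) (h : ∀ i, Rec (f i)) :
    Rec (∑ i ∈ s, f i) :=
  Finset.sum_induction f Rec (fun _ _ => Rec.add) Rec.zero (fun i _ => h i)

lemma Rec.comp {f : D → H} (hf : Rec f) (L : H →ₗ[ℤ] H') : Rec (fun x => L (f x)) := by
  obtain ⟨M, hM, hs, hfM⟩ := hf
  let C : (D → H) →ₗ[ℤ] (D → H') := L.compLeft D
  refine ⟨M.map C, hM.map C, ?_, ⟨f, hfM, rfl⟩⟩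
  rintro d _ ⟨g, hg, rfl⟩
  exact ⟨shift H d g, hs d g hg, rfl⟩

lemma Rec.mul {f g : D → R} (hf : Rec f) (hg : Rec g) : Rec (f * g) := by
  obtain ⟨M, hM, hs, hfM⟩ := hf
  obtain ⟨M', hM', hs', hfM'⟩ := hg
  refine ⟨M * M', hM.mul hM', ?_, Submodule.mul_mem_mul hfM hfM'⟩
  intro d g hg
  induction hg using Submodule.mul_induction_on' with
  | mem_mul_mem a ha b hb =>
    exact Submodule.mul_mem_mul (hs d a ha) (hs' d b hb)
  | add x _ y _ hx hy => rw [map_add]; exact add_mem hx hy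

lemma Rec.const (c : H) : Rec (fun _ : D => c) := by
  refine ⟨Submodule.span ℤ {fun _ => c}, Submodule.fg_span_singleton _, ?_,
    Submodule.mem_span_singleton_self _⟩
  intro d g hg
  obtain ⟨k, rfl⟩ := Submodule.mem_span_singleton.1 hg
  rw [map_smul]
  exact Submodule.smul_mem _ _ (Submodule.mem_span_singleton_self _)

lemma Rec.hom (φ : D →+ ℕ) : Rec (fun x : D => ((φ x : ℕ) : R)) := by
  refine ⟨Submodule.span ℤ {fun x => ((φ x : ℕ) : R), fun _ => 1},
    Submodule.fg_span (by simp), ?_, Submodule.subset_span (by simp)⟩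
  intro d g hg
  obtain ⟨a, b, rfl⟩ := Submodule.mem_span_pair.1 hg
  refine Submodule.mem_span_pair.2 ⟨a, a * φ d + b, ?_⟩
  funext x
  simp [shift_apply]
  ring

lemma Rec.pow (φ : D →+ ℕ) (α : R) (hα : IsIntegral ℤ α) : Rec (fun x : D => α ^ φ x) := by
  let C : R →ₗ[ℤ] (D → R) :=
    { toFun := fun c x => c * α ^ φ x
      map_add' := fun a b => by funext x; simp [add_mul]
      map_smul' := fun a b => by funext x; simp [mul_assoc] }
  refine ⟨(Subalgebra.toSubmodule (Algebra.adjoin ℤ {α})).map C,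
    hα.fg_adjoin_singleton.map C, ?_, ⟨1, one_mem (Algebra.adjoin ℤ {α}), ?_⟩⟩
  · rintro d _ ⟨c, hc, rfl⟩
    refine ⟨c * α ^ φ d, ?_, ?_⟩
    · exact mul_mem (S := Subalgebra ℤ R) hc
        (pow_mem (Algebra.subset_adjoin (by simp)) _)
    · funext x
      simp only [C, shift_apply, LinearMap.coe_mk, AddHom.coe_mk, map_add, pow_add]
      ring
  · funext x
    simp [C]

lemma Rec.expPoly {n : ℕ} (hR : ∀ a : R, IsIntegral ℤ a) (f : (Fin n → ℕ) → R)
    (hf : IsExpPolyFun R n f) : Rec f := by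
  obtain ⟨m, α, P, hP⟩ := hf
  rw [show f = _ from funext hP]
  clear hP
  induction P using MvPolynomial.induction_on with
  | C a => simpa using Rec.const a
  | add p q hp hq => simp only [map_add]; exact hp.add hq
  | mul_X p i hp =>
    simp only [map_mul, MvPolynomial.eval_X]
    refine hp.mul ?_
    rcases i with i | ⟨i, j⟩
    · exact Rec.hom (Pi.evalAddMonoidHom (fun _ : Fin n => ℕ) i)
    · exact Rec.pow (Pi.evalAddMonoidHom (fun _ : Fin n => ℕ) i) (α j) (hR _)

end

def two : ℚˣ := Units.mk0 2 (by norm_num)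

lemma two_zpow_eq_one (k : ℤ) : two ^ k = 1 ↔ k = 0 := by
  rw [Units.ext_iff]
  simp only [two, Units.val_zpow_eq_zpow_val, Units.val_mk0, Units.val_one]
  exact zpow_eq_one_iff_right₀ (by norm_num) (by norm_num)

lemma prod_two_zpow {N : ℕ} (v : Fin N → ℤ) : ∏ j, two ^ v j = two ^ ∑ j, v j := by
  induction N with
  | zero => simp
  | succ N ih => rw [Fin.prod_univ_succ, Fin.sum_univ_succ, ih, _root_.zpow_add]

lemma monomialMap_two {s N : ℕ} (A : Matrix (Fin s) (Fin N) ℤ) (v : Fin N → ℤ) :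
    monomialMap A (fun j => two ^ v j) = fun j => two ^ (A.mulVec v j) := by
  funext i
  simp only [monomialMap, MonoidHom.coe_mk, OneHom.coe_mk, Matrix.mulVec, dotProduct]
  rw [← prod_two_zpow]
  refine Finset.prod_congr rfl fun j _ => ?_
  rw [← _root_.zpow_mul, mul_comm]

lemma rec_main {H : Type*} [AddCommGroup H] [Module.IsTorsionFree ℤ H] {n : ℕ}
    (f : (Fin n → ℕ) → H) (hf : Rec f) :
    ∃ (N s : ℕ) (A : Fin n → Matrix (Fin N) (Fin N) ℤ)
      (B : Matrix (Fin s) (Fin N) ℤ) (P : Fin N → ℚˣ),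
      (∀ i i', A i * A i' = A i' * A i) ∧
      {ℓ | f ℓ = 0} =
        {ℓ | iterComp (fun i => ⇑(monomialMap (A i))) ℓ P ∈ (monomialMap B).ker} := by
  obtain ⟨M, hM, hs, hfM⟩ := hf
  have : Module.Finite ℤ M := Module.Finite.iff_fg.2 hM
  let d : Fin n → (Fin n → ℕ) := fun i => Pi.single i 1
  let T : Fin n → (M →ₗ[ℤ] M) := fun i => (shift _ (d i)).restrict (hs (d i))
  let L0 : M →ₗ[ℤ] H := (LinearMap.proj (0 : Fin n → ℕ)).comp M.subtype
  let L := L0.rangeRestrict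
  let b := Module.finBasis ℤ M
  let b' := Module.finBasis ℤ (LinearMap.range L0)
  let e : M → (Fin _ → ℚˣ) := fun g j => two ^ (b.repr g j)
  refine ⟨_, _, fun i => LinearMap.toMatrix b b (T i), LinearMap.toMatrix b b' L,
    e ⟨f, hfM⟩, ?_, ?_⟩
  · intro i i'
    rw [← LinearMap.toMatrix_comp b b b, ← LinearMap.toMatrix_comp b b b]
    congr 1
    ext g x
    simp [T, shift_apply, add_right_comm]
  · ext ℓ
    have h1 := iterComp_semiconj (fun i => ⇑(monomialMap (LinearMap.toMatrix b b (T i))))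
      (fun i => ⇑(T i)) e (by
        intro i g
        simp only [e]
        rw [monomialMap_two, LinearMap.toMatrix_mulVec_repr]) ℓ ⟨f, hfM⟩
    have h2 := iterComp_semiconj (fun i => ⇑(shift H (d i)))
      (fun i => ⇑(T i)) (fun g : M => (g : (Fin n → ℕ) → H)) (fun i g => rfl) ℓ ⟨f, hfM⟩
    have h3 := iterComp_shift d ℓ f 0
    have h4 : ∑ i, ℓ i • d i = ℓ := by
      funext j
      simp [d, Finset.sum_apply, Pi.single_apply]
    rw [h4, zero_add] at h3
    simp only [Set.mem_ofPred_eq]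
    rw [h1, MonoidHom.mem_ker]
    generalize iterComp (fun i => ⇑(T i)) ℓ ⟨f, hfM⟩ = g at h2
    simp only [e]
    rw [monomialMap_two, LinearMap.toMatrix_mulVec_repr, ← h3, h2]
    have h5 : (g : (Fin n → ℕ) → H) 0 = 0 ↔ L g = 0 := by
      rw [Subtype.ext_iff]; rfl
    rw [h5, ← b'.repr.map_eq_zero_iff, Finsupp.ext_iff, funext_iff]
    simp [two_zpow_eq_one]

end TorusReturn

open TorusReturn in
/-- Every exponential-polynomial set over the ring of all algebraic integers is the
return set of a dynamical system given by commuting endomorphisms of a power of the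
multiplicative group, with target an algebraic subgroup. -/
theorem algInt_expPolySet_is_torus_return_set
    (n : ℕ) (Z : Set (Fin n → ℕ)) (hZ : IsExpPolySet AlgInt n Z) :
    ∃ (N s : ℕ) (A : Fin n → Matrix (Fin N) (Fin N) ℤ)
      (B : Matrix (Fin s) (Fin N) ℤ) (P : Fin N → ℚˣ),
      (∀ i i', A i * A i' = A i' * A i) ∧
      Z = {ℓ | iterComp (fun i => ⇑(monomialMap (A i))) ℓ P ∈ (monomialMap B).ker} := by
  obtain ⟨m, f, hf, rfl⟩ := hZ
  have hint : ∀ a : AlgInt, IsIntegral ℤ a := fun a =>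
    integralClosure.isIntegral (R := ℤ) (A := AlgebraicClosure ℚ) a
  have : IsDomain AlgInt := inferInstanceAs (IsDomain (integralClosure ℤ (AlgebraicClosure ℚ)))
  have : CharZero AlgInt :=
    inferInstanceAs (CharZero (integralClosure ℤ (AlgebraicClosure ℚ)))
  have hrec : Rec (∑ i, fun ℓ => LinearMap.single ℤ (fun _ : Fin m => AlgInt) i (f i ℓ)) :=
    Rec.sum _ _ fun i => (Rec.expPoly hint (f i) (hf i)).comp _
  have heq : (⋂ i, {ℓ | f i ℓ = 0}) = {ℓ |
      (∑ i, fun ℓ => LinearMap.single ℤ (fun _ : Fin m => AlgInt) i (f i ℓ)) ℓ = 0} := by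
    ext ℓ
    simp only [Set.mem_iInter, Set.mem_ofPred_eq, funext_iff]
    refine forall_congr' fun i => ?_
    simp [Finset.sum_apply, Pi.single_apply]
  rw [heq]
  exact rec_main _ hrec
end
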